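/- In the mixed rough Bergomi model, for every q > 1 and every t ∈ (0,1], the q-th moment of the integrated variance satisfies E[ ( (1/t)∫₀ᵗ v^{(γ,ν)}_s ds )^q ] ≤ (v₀^q·n^q / t^{q−1})·exp( ((ν*)²/2)·(q² − q)·t^β ), where ν* := max{ν₁,…,ν_n} = ν_n. -/

import Mathlib

open MeasureTheory ProbabilityTheory Set
open scoped ENNReal NNReal

noncomputable section

/-- The time interval `[0,1]`. -/
abbrev I01 : Set ℝ := Set.Icc (0:ℝ) 1

/-- Jensen's inequality for `x ↦ x ^ q` and an unnormalised measure. -/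
lemma lintegral_rpow_le_measure_univ_rpow_mul {X : Type*} [MeasurableSpace X] (μ : Measure X)
    {q : ℝ} (hq : 1 ≤ q) {g : X → ℝ≥0∞} (hg : AEMeasurable g μ) :
    (∫⁻ x, g x ∂μ) ^ q ≤ μ univ ^ (q - 1) * ∫⁻ x, g x ^ q ∂μ := by
  have hq0 : 0 < q := by linarith
  have h := eLpNorm'_le_eLpNorm'_mul_rpow_measure_univ one_pos hq hg.aestronglyMeasurable
  simp only [eLpNorm'_eq_lintegral_enorm, enorm_eq_self, ENNReal.rpow_one, div_one] at h
  calc (∫⁻ x, g x ∂μ) ^ q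
      ≤ ((∫⁻ x, g x ^ q ∂μ) ^ (1 / q) * μ univ ^ (1 - 1 / q)) ^ q :=
        ENNReal.rpow_le_rpow h hq0.le
    _ = μ univ ^ (q - 1) * ∫⁻ x, g x ^ q ∂μ := by
        rw [ENNReal.mul_rpow_of_nonneg _ _ hq0.le, ← ENNReal.rpow_mul, ← ENNReal.rpow_mul,
          one_div_mul_cancel hq0.ne', ENNReal.rpow_one, sub_mul, one_div_mul_cancel hq0.ne',
          one_mul, mul_comm]

/-- The time average of a nonnegative function satisfies Jensen's inequality for `x ↦ x ^ q`;
no integrability is needed. -/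
lemma ofReal_average_rpow_le {q t : ℝ} (hq : 1 ≤ q) (ht : 0 < t) {f : ℝ → ℝ}
    (hf : Measurable f) (hf0 : ∀ s, 0 ≤ f s) :
    ENNReal.ofReal (((1 / t) * ∫ s in Icc 0 t, f s) ^ q) ≤
      (ENNReal.ofReal t)⁻¹ * ∫⁻ s in Icc 0 t, ENNReal.ofReal (f s ^ q) := by
  have hq0 : 0 ≤ q := by linarith
  have hT0 : ENNReal.ofReal t ≠ 0 := by simpa using ht
  have hint : ENNReal.ofReal (∫ s in Icc 0 t, f s) ≤
      ∫⁻ s in Icc 0 t, ENNReal.ofReal (f s) := by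
    rw [integral_eq_lintegral_of_nonneg_ae (.of_forall hf0) hf.aestronglyMeasurable]
    exact ENNReal.ofReal_toReal_le
  have hjensen := lintegral_rpow_le_measure_univ_rpow_mul (volume.restrict (Icc 0 t)) hq
    (g := fun s => ENNReal.ofReal (f s)) hf.ennreal_ofReal.aemeasurable
  simp only [Measure.restrict_apply_univ, Real.volume_Icc, sub_zero,
    ENNReal.ofReal_rpow_of_nonneg (hf0 _) hq0] at hjensen
  have hI0 : 0 ≤ ∫ s in Icc 0 t, f s := integral_nonneg hf0
  rw [← ENNReal.ofReal_rpow_of_nonneg (by positivity) hq0,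
    ENNReal.ofReal_mul (by positivity), one_div, ENNReal.ofReal_inv_of_pos ht,
    ENNReal.mul_rpow_of_nonneg _ _ hq0]
  calc (ENNReal.ofReal t)⁻¹ ^ q * ENNReal.ofReal (∫ s in Icc 0 t, f s) ^ q
      ≤ (ENNReal.ofReal t)⁻¹ ^ q * (ENNReal.ofReal t ^ (q - 1) *
          ∫⁻ s in Icc 0 t, ENNReal.ofReal (f s ^ q)) := by
        gcongr
        exact (ENNReal.rpow_le_rpow hint hq0).trans hjensen
    _ = (ENNReal.ofReal t)⁻¹ * ∫⁻ s in Icc 0 t, ENNReal.ofReal (f s ^ q) := by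
        rw [← mul_assoc, ENNReal.inv_rpow, ← ENNReal.rpow_neg,
          ← ENNReal.rpow_add _ _ hT0 ENNReal.ofReal_ne_top, ← ENNReal.rpow_neg_one]
        ring_nf

/-- A uniform bound on the `q`-th moments of a nonnegative process bounds the `q`-th moment of its
time average. -/
lemma lintegral_average_rpow_le {Ω : Type*} [MeasurableSpace Ω] (P : Measure Ω) [SFinite P]
    {q t : ℝ} (hq : 1 ≤ q) (ht : 0 < t) {f : Ω → ℝ → ℝ}
    (hf : Measurable (Function.uncurry f)) (hf0 : ∀ ω s, 0 ≤ f ω s) {C : ℝ≥0∞}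
    (hC : ∀ s ∈ Icc 0 t, ∫⁻ ω, ENNReal.ofReal (f ω s ^ q) ∂P ≤ C) :
    ∫⁻ ω, ENNReal.ofReal (((1 / t) * ∫ s in Icc 0 t, f ω s) ^ q) ∂P ≤ C := by
  have hT0 : ENNReal.ofReal t ≠ 0 := by simpa using ht
  calc ∫⁻ ω, ENNReal.ofReal (((1 / t) * ∫ s in Icc 0 t, f ω s) ^ q) ∂P
      ≤ ∫⁻ ω, (ENNReal.ofReal t)⁻¹ * (∫⁻ s in Icc 0 t, ENNReal.ofReal (f ω s ^ q)) ∂P :=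
        lintegral_mono fun ω => ofReal_average_rpow_le hq ht hf.of_uncurry_left (hf0 ω)
    _ = (ENNReal.ofReal t)⁻¹ *
          ∫⁻ s in Icc 0 t, ∫⁻ ω, ENNReal.ofReal (f ω s ^ q) ∂P := by
        rw [lintegral_const_mul' _ _ (ENNReal.inv_ne_top.2 hT0), lintegral_lintegral_swap]
        exact ((hf.pow_const q).ennreal_ofReal).aemeasurable
    _ ≤ (ENNReal.ofReal t)⁻¹ * ∫⁻ _ in Icc 0 t, C := by
        gcongr 1
        exact setLIntegral_mono measurable_const hC
    _ = C := by
        rw [setLIntegral_const, Real.volume_Icc, sub_zero, mul_comm C, ← mul_assoc,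
          ENNReal.inv_mul_cancel hT0 ENNReal.ofReal_ne_top, one_mul]

/-- Exponential moments of a centred Gaussian variable. -/
lemma lintegral_ofReal_exp_of_map_eq_gaussianReal {Ω : Type*} [MeasurableSpace Ω] {P : Measure Ω}
    {X : Ω → ℝ} (hX : Measurable X) {v : ℝ≥0} (hlaw : P.map X = gaussianReal 0 v) (a b : ℝ) :
    ∫⁻ ω, ENNReal.ofReal (Real.exp (a * X ω - b)) ∂P =
      ENNReal.ofReal (Real.exp (v * a ^ 2 / 2 - b)) := by
  have hint : Integrable (fun ω => Real.exp (a * X ω)) P := by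
    have h := integrable_exp_mul_gaussianReal (μ := 0) (v := v) a
    rw [← hlaw] at h
    exact h.comp_measurable hX
  have hmgf := mgf_gaussianReal hlaw a
  rw [mgf, zero_mul, zero_add] at hmgf
  simp only [Real.exp_sub]
  rw [← ofReal_integral_eq_lintegral_ofReal (hint.div_const _)
    (.of_forall fun ω => by positivity), integral_div, hmgf]

/-- The `q`-th moment of a mixture of log-normal variables driven by one centred Gaussian. -/
lemma lintegral_mixture_exp_rpow_le {Ω ι : Type*} [MeasurableSpace Ω] [Fintype ι] {P : Measure Ω}
    {X : Ω → ℝ} (hX : Measurable X) {η c v₀ q N : ℝ} (hη : 0 < η) (hc : 0 ≤ c) (hv₀ : 0 ≤ v₀)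
    (hq : 1 ≤ q) (hlaw : P.map X = gaussianReal 0 (Real.toNNReal (η ^ 2 * c)))
    {γ ν : ι → ℝ} (hγ : ∀ i, 0 ≤ γ i) (hγsum : ∑ i, γ i = 1) (hν : ∀ i, 0 ≤ ν i)
    (hνN : ∀ i, ν i ≤ N) :
    ∫⁻ ω, ENNReal.ofReal
        ((v₀ * ∑ i, γ i * Real.exp (ν i / η * X ω - ν i ^ 2 / 2 * c)) ^ q) ∂P ≤
      ENNReal.ofReal (v₀ ^ q * Real.exp (N ^ 2 / 2 * (q ^ 2 - q) * c)) := by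
  have hq2 : 0 ≤ q ^ 2 - q := by nlinarith
  have hterm : ∀ i, ∫⁻ ω, ENNReal.ofReal
      (Real.exp (q * (ν i / η) * X ω - q * (ν i ^ 2 / 2 * c))) ∂P ≤
        ENNReal.ofReal (Real.exp (N ^ 2 / 2 * (q ^ 2 - q) * c)) := by
    intro i
    rw [lintegral_ofReal_exp_of_map_eq_gaussianReal hX hlaw, Real.coe_toNNReal _ (by positivity)]
    have hexp : η ^ 2 * c * (q * (ν i / η)) ^ 2 / 2 - q * (ν i ^ 2 / 2 * c) =
        ν i ^ 2 / 2 * (q ^ 2 - q) * c := by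
      field_simp
    rw [hexp]
    have := hν i
    have := hνN i
    gcongr
  calc ∫⁻ ω, ENNReal.ofReal
        ((v₀ * ∑ i, γ i * Real.exp (ν i / η * X ω - ν i ^ 2 / 2 * c)) ^ q) ∂P
      ≤ ∫⁻ ω, ENNReal.ofReal (v₀ ^ q) * ∑ i, ENNReal.ofReal (γ i) * ENNReal.ofReal
          (Real.exp (q * (ν i / η) * X ω - q * (ν i ^ 2 / 2 * c))) ∂P := by
        refine lintegral_mono fun ω => ?_
        simp only [← ENNReal.ofReal_mul (hγ _)]
        rw [← ENNReal.ofReal_sum_of_nonneg fun i _ => mul_nonneg (hγ i) (Real.exp_pos _).le,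
          ← ENNReal.ofReal_mul (by positivity), Real.mul_rpow hv₀
            (Finset.sum_nonneg fun i _ => mul_nonneg (hγ i) (Real.exp_pos _).le)]
        refine ENNReal.ofReal_le_ofReal (mul_le_mul_of_nonneg_left ?_ (by positivity))
        refine (Real.rpow_arith_mean_le_arith_mean_rpow _ _ _ (fun i _ => hγ i) hγsum
          (fun i _ => (Real.exp_pos _).le) hq).trans_eq ?_
        refine Finset.sum_congr rfl fun i _ => ?_
        rw [← Real.exp_mul]
        ring_nf
    _ = ENNReal.ofReal (v₀ ^ q) * ∑ i, ENNReal.ofReal (γ i) * ∫⁻ ω, ENNReal.ofReal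
          (Real.exp (q * (ν i / η) * X ω - q * (ν i ^ 2 / 2 * c))) ∂P := by
        rw [lintegral_const_mul' _ _ ENNReal.ofReal_ne_top,
          lintegral_finsetSum _ fun i _ => by fun_prop]
        simp only [lintegral_const_mul' _ _ ENNReal.ofReal_ne_top]
    _ ≤ ENNReal.ofReal (v₀ ^ q) * ∑ i, ENNReal.ofReal (γ i) *
          ENNReal.ofReal (Real.exp (N ^ 2 / 2 * (q ^ 2 - q) * c)) := by
        gcongr with i
        exact hterm i
    _ = ENNReal.ofReal (v₀ ^ q * Real.exp (N ^ 2 / 2 * (q ^ 2 - q) * c)) := by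
        rw [← Finset.sum_mul, ← ENNReal.ofReal_sum_of_nonneg fun i _ => hγ i, hγsum,
          ENNReal.ofReal_one, one_mul, ENNReal.ofReal_mul (by positivity)]

/-- Lemma 3.11: moment bound for the integrated variance in the mixed rough
Bergomi model:
`E[((1/t)∫₀ᵗ v^{(γ,ν)}_s ds)^q] ≤ (v₀^q n^q / t^{q-1}) exp(((ν*)²/2)(q²-q) t^β)`. -/
theorem mixed_rough_bergomi_moment_bound
    {Ω : Type*} [MeasurableSpace Ω] (P : Measure Ω) [IsProbabilityMeasure P]
    (α β η v0 : ℝ) (hα : α ∈ Set.Ioo (-(1:ℝ)/2) 0) (hβ : β = 2*α+1)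
    (hη : 0 < η) (hv0 : 0 < v0)
    (n : ℕ) (hn : 0 < n)
    (γ : Fin n → ℝ) (hγ : ∀ i, γ i ∈ Set.Icc (0:ℝ) 1) (hγsum : ∑ i, γ i = 1)
    (ν : Fin n → ℝ) (hνmono : StrictMono ν) (hνpos : ∀ i, 0 < ν i)
    (Z : Ω → ℝ → ℝ)
    (hZmeas : Measurable (Function.uncurry Z))
    (hZlaw : ∀ s ∈ I01, Measure.map (fun ω => Z ω s) P =
      gaussianReal 0 (Real.toNNReal (η^2 * s ^ β))) :
    ∀ q : ℝ, 1 < q → ∀ t ∈ Set.Ioc (0:ℝ) 1,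
      ∫⁻ ω, ENNReal.ofReal
          (((1/t) * ∫ s in Set.Icc 0 t,
            v0 * ∑ i, γ i * Real.exp ((ν i / η) * Z ω s - (ν i)^2/2 * s ^ β)) ^ q) ∂P ≤
        ENNReal.ofReal ((v0 ^ q * (n:ℝ) ^ q / t ^ (q-1)) *
          Real.exp ((ν ⟨n-1, Nat.sub_lt hn one_pos⟩)^2 / 2 * (q^2 - q) * t ^ β)) := by
  intro q hq t ⟨ht0, ht1⟩
  have hβ0 : 0 ≤ β := by linarith [hα.1]
  have hq2 : 0 ≤ q ^ 2 - q := by nlinarith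
  have hmeas : Measurable (Function.uncurry fun (ω : Ω) (s : ℝ) =>
      v0 * ∑ i, γ i * Real.exp ((ν i / η) * Z ω s - (ν i)^2/2 * s ^ β)) := by
    have hZ : Measurable fun p : Ω × ℝ => Z p.1 p.2 := hZmeas
    simp only [Function.uncurry_def]
    fun_prop
  have hνmax : ∀ i, ν i ≤ ν ⟨n-1, Nat.sub_lt hn one_pos⟩ := fun i =>
    hνmono.monotone (Fin.le_def.2 (Nat.le_sub_one_of_lt i.2))
  refine lintegral_average_rpow_le P hq.le ht0 hmeas
    (fun ω s => mul_nonneg hv0.le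
      (Finset.sum_nonneg fun i _ => mul_nonneg (hγ i).1 (Real.exp_pos _).le)) ?_
  intro s hs
  refine (lintegral_mixture_exp_rpow_le hZmeas.of_uncurry_right hη
    (Real.rpow_nonneg hs.1 β) hv0.le hq.le (hZlaw s ⟨hs.1, hs.2.trans ht1⟩)
    (fun i => (hγ i).1) hγsum (fun i => (hνpos i).le) hνmax).trans
    (ENNReal.ofReal_le_ofReal ?_)
  have hn1 : (1:ℝ) ≤ (n:ℝ) ^ q :=
    Real.one_le_rpow (by exact_mod_cast hn) (by linarith)
  have ht1' : t ^ (q - 1) ≤ 1 := Real.rpow_le_one ht0.le ht1 (by linarith)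
  have hv0q : 0 ≤ v0 ^ q := Real.rpow_nonneg hv0.le q
  have hconst : v0 ^ q ≤ v0 ^ q * (n:ℝ) ^ q / t ^ (q - 1) := by
    rw [le_div_iff₀ (Real.rpow_pos_of_pos ht0 _)]
    exact mul_le_mul_of_nonneg_left (ht1'.trans hn1) hv0q
  have hsβ : s ^ β ≤ t ^ β := Real.rpow_le_rpow hs.1 hs.2 hβ0
  gcongr

end
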